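/- Let f be a locally integrable function on ℝⁿ with ‖f‖_{BMO} < ∞, φ a Schwartz function with ∫φ = 1, and B = B(x₀, r). Then there exists C depending only on n and φ such that ess sup_{x,y ∈ B} ∫_r^∞ |∂/∂t [Φ_t(f − f_B)(x) − Φ_t(f − f_B)(y)]| dt ≤ C ‖f‖_{BMO}, where Φ_t g := φ_t * g with φ_t(x) := t^{-n}φ(x/t). -/

import Mathlib

open MeasureTheory Metric

/-- Dilation `φ_t(x) = t^{-n} φ(x/t)` of a Schwartz function. -/
noncomputable def schwartzDil {n : ℕ} (φ : SchwartzMap (EuclideanSpace ℝ (Fin n)) ℝ)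
    (t : ℝ) (x : EuclideanSpace ℝ (Fin n)) : ℝ :=
  t ^ (-(n : ℤ)) * φ (t⁻¹ • x)

/-- A Schwartz function is locally Lipschitz, with a constant that decays rapidly. -/
theorem SchwartzMap.exists_abs_sub_le {E : Type*} [NormedAddCommGroup E] [NormedSpace ℝ E]
    (ψ : SchwartzMap E ℝ) (k : ℕ) :
    ∃ C > 0, ∀ u v w : E, ‖u - w‖ < 1 → ‖v - w‖ < 1 →
      |ψ u - ψ v| ≤ C * ((1 + ‖w‖) ^ k)⁻¹ * ‖u - v‖ := by
  obtain ⟨A, hA0, hA⟩ : ∃ A > 0, ∀ p : E, (1 + ‖p‖) ^ k * ‖fderiv ℝ ψ p‖ ≤ A := by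
    have h := SchwartzMap.one_add_le_sup_seminorm_apply (𝕜 := ℝ) (m := (k, 1)) le_rfl le_rfl ψ
    simp only [norm_iteratedFDeriv_one] at h
    refine ⟨_, add_pos_of_nonneg_of_pos (le_trans (by positivity) (h 0)) one_pos, fun p => ?_⟩
    exact (h p).trans (lt_add_one _).le
  refine ⟨2 ^ k * A, by positivity, fun u v w hu hv => ?_⟩
  refine Convex.norm_image_sub_le_of_norm_fderiv_le (𝕜 := ℝ) (s := ball w 1)
    (fun p _ => ψ.differentiableAt) (fun p hp => ?_) (convex_ball w 1)
    (mem_ball_iff_norm.2 hv) (mem_ball_iff_norm.2 hu)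
  have h1 : 1 + ‖w‖ ≤ 2 * (1 + ‖p‖) := by
    have := norm_le_norm_add_norm_sub p w
    have := mem_ball_iff_norm.1 hp
    nlinarith [norm_nonneg p]
  have h2 : (1 + ‖w‖) ^ k ≤ 2 ^ k * (1 + ‖p‖) ^ k := by
    rw [← mul_pow]; gcongr
  rw [← div_eq_mul_inv, le_div_iff₀ (by positivity)]
  calc ‖fderiv ℝ ψ p‖ * (1 + ‖w‖) ^ k ≤ ‖fderiv ℝ ψ p‖ * (2 ^ k * (1 + ‖p‖) ^ k) := by gcongr
    _ = 2 ^ k * ((1 + ‖p‖) ^ k * ‖fderiv ℝ ψ p‖) := by ring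
    _ ≤ 2 ^ k * A := by gcongr; exact hA p

/-- The `t`-derivative of `t^{-n} φ(x/t)` is `t^{-n-1} ψ(x/t)` for a Schwartz function `ψ`. -/
theorem exists_hasDerivAt_schwartzDil {n : ℕ} (φ : SchwartzMap (EuclideanSpace ℝ (Fin n)) ℝ) :
    ∃ ψ : SchwartzMap (EuclideanSpace ℝ (Fin n)) ℝ, ∀ x, ∀ t : ℝ, t ≠ 0 →
      HasDerivAt (fun s => schwartzDil φ s x) (t ^ (-(n : ℤ) - 1) * ψ (t⁻¹ • x)) t := by
  let χ : SchwartzMap (EuclideanSpace ℝ (Fin n)) ℝ :=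
    SchwartzMap.bilinLeftCLM (ContinuousLinearMap.id ℝ (EuclideanSpace ℝ (Fin n) →L[ℝ] ℝ))
      (g := fun x => x) (by fun_prop) (SchwartzMap.fderivCLM ℝ _ _ φ)
  have hχ : ∀ x, χ x = fderiv ℝ φ x x := fun x => rfl
  refine ⟨-((n : ℝ) • φ + χ), fun x t ht => ?_⟩
  have h1 := hasDerivAt_zpow (-(n : ℤ)) t (Or.inl ht)
  have h2 : HasDerivAt (fun s : ℝ => s⁻¹ • x) ((-(t ^ 2)⁻¹) • x) t := (hasDerivAt_inv ht).smul_const x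
  have h3 := (φ.differentiableAt (x := t⁻¹ • x)).hasFDerivAt.comp_hasDerivAt t h2
  refine (h1.mul h3).congr_deriv ?_
  simp only [neg_apply, add_apply, smul_apply, hχ, map_smul,
    smul_eq_mul, Function.comp]
  rw [zpow_sub_one₀ ht]
  push_cast
  field_simp
  ring

/-- Pointwise bound for the difference of two translates of the `t`-derivative of the kernel. -/
theorem exists_abs_kernel_sub_le {n : ℕ} (ψ : SchwartzMap (EuclideanSpace ℝ (Fin n)) ℝ) :
    ∃ C > 0, ∀ (x₀ x y z : EuclideanSpace ℝ (Fin n)) (r t : ℝ), 0 < r → r ≤ t →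
      x ∈ ball x₀ r → y ∈ ball x₀ r →
      |t ^ (-(n : ℤ) - 1) * ψ (t⁻¹ • (x - z)) - t ^ (-(n : ℤ) - 1) * ψ (t⁻¹ • (y - z))| ≤
        C * r * t ^ (-(3 / 2) : ℝ) * (r + ‖z - x₀‖) ^ (-(n + 1 / 2) : ℝ) := by
  obtain ⟨C, hC0, hC⟩ := ψ.exists_abs_sub_le (n + 1)
  refine ⟨2 * C, by positivity, fun x₀ x y z r t hr hrt hx hy => ?_⟩
  have ht : 0 < t := hr.trans_le hrt
  have hlt : ∀ x ∈ ball x₀ r, ‖t⁻¹ • (x - z) - t⁻¹ • (x₀ - z)‖ < 1 := fun x hx => by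
    rw [← smul_sub, norm_smul, sub_sub_sub_cancel_right, norm_inv, Real.norm_of_nonneg ht.le,
      inv_mul_lt_iff₀ ht, mul_one]
    exact (mem_ball_iff_norm.1 hx).trans_le hrt
  have hxy : ‖t⁻¹ • (x - z) - t⁻¹ • (y - z)‖ ≤ t⁻¹ * (2 * r) := by
    rw [← smul_sub, norm_smul, sub_sub_sub_cancel_right, norm_inv, Real.norm_of_nonneg ht.le]
    gcongr
    rw [← dist_eq_norm]
    linarith [dist_triangle_right x y x₀, mem_ball.1 hx, mem_ball.1 hy]
  have hw : ‖t⁻¹ • (x₀ - z)‖ = t⁻¹ * ‖z - x₀‖ := by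
    rw [norm_smul, norm_inv, Real.norm_of_nonneg ht.le, norm_sub_rev]
  have hdecay : ((1 + ‖t⁻¹ • (x₀ - z)‖) ^ (n + 1))⁻¹ ≤
      t ^ (n + 1 / 2 : ℝ) * (r + ‖z - x₀‖) ^ (-(n + 1 / 2) : ℝ) := by
    have h1 : 1 + ‖t⁻¹ • (x₀ - z)‖ = t⁻¹ * (t + ‖z - x₀‖) := by
      rw [hw]; field_simp
    have h2 : 1 ≤ 1 + ‖t⁻¹ • (x₀ - z)‖ := by simp
    calc ((1 + ‖t⁻¹ • (x₀ - z)‖) ^ (n + 1))⁻¹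
        = (1 + ‖t⁻¹ • (x₀ - z)‖) ^ (-(n + 1) : ℝ) := by
          rw [Real.rpow_neg (by positivity)]; norm_cast
      _ ≤ (1 + ‖t⁻¹ • (x₀ - z)‖) ^ (-(n + 1 / 2) : ℝ) :=
          Real.rpow_le_rpow_of_exponent_le h2 (by linarith)
      _ = t ^ (n + 1 / 2 : ℝ) * (t + ‖z - x₀‖) ^ (-(n + 1 / 2) : ℝ) := by
          rw [h1, Real.mul_rpow (by positivity) (by positivity), Real.inv_rpow ht.le,
            Real.rpow_neg ht.le, inv_inv]
      _ ≤ _ := by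
          gcongr ?_ * ?_
          apply Real.rpow_le_rpow_of_nonpos (by positivity) (by gcongr)
          have : (0 : ℝ) ≤ n := n.cast_nonneg
          linarith
  have hpow : t ^ (-(n : ℤ) - 1) * t⁻¹ * t ^ (n + 1 / 2 : ℝ) = t ^ (-(3 / 2) : ℝ) := by
    rw [← Real.rpow_intCast, ← Real.rpow_neg_one, ← Real.rpow_add ht, ← Real.rpow_add ht]
    congr 1
    push_cast
    ring
  rw [← mul_sub, abs_mul, abs_of_pos (zpow_pos ht _)]
  calc _ ≤ t ^ (-(n : ℤ) - 1) * (C * (t ^ (n + 1 / 2 : ℝ) *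
        (r + ‖z - x₀‖) ^ (-(n + 1 / 2) : ℝ)) * (t⁻¹ * (2 * r))) := by
        gcongr
        exact (hC _ _ _ (hlt x hx) (hlt y hy)).trans (by gcongr)
    _ = 2 * C * r * (t ^ (-(n : ℤ) - 1) * t⁻¹ * t ^ (n + 1 / 2 : ℝ)) *
        (r + ‖z - x₀‖) ^ (-(n + 1 / 2) : ℝ) := by ring
    _ = _ := by rw [hpow]

theorem MeasureTheory.LocallyIntegrable.integrableOn_ball {E : Type*} [PseudoMetricSpace E]
    [ProperSpace E] [MeasurableSpace E] {μ : Measure E} {f : E → ℝ}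
    (hf : LocallyIntegrable f μ) (x : E) (r : ℝ) : IntegrableOn f (ball x r) μ :=
  (hf.integrableOn_isCompact (isCompact_closedBall x r)).mono_set ball_subset_closedBall

theorem nonneg_of_average_abs_le {α : Type*} [MeasurableSpace α] {μ : Measure α}
    {f : α → ℝ} {s : Set α} {c M : ℝ}
    (hM : ⨍ y in s, |f y - c| ∂μ ≤ M) : 0 ≤ M := by
  refine le_trans ?_ hM
  rw [setAverage_eq]
  exact smul_nonneg (by positivity) (integral_nonneg fun _ => abs_nonneg _)

theorem measureReal_ball_pos {E : Type*} [NormedAddCommGroup E] [NormedSpace ℝ E]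
    [FiniteDimensional ℝ E] [MeasurableSpace E] (μ : Measure E) [μ.IsAddHaarMeasure] (x : E) {r : ℝ}
    (hr : 0 < r) : 0 < μ.real (ball x r) :=
  ENNReal.toReal_pos (measure_ball_pos μ x hr).ne' measure_ball_lt_top.ne

section MeanOscillation

open Module Filter

variable {E : Type*} [NormedAddCommGroup E] [NormedSpace ℝ E] [FiniteDimensional ℝ E]
  [MeasurableSpace E] {μ : Measure E} [μ.IsAddHaarMeasure]

theorem integrableOn_ball_abs_sub_const {f : E → ℝ} (hf : LocallyIntegrable f μ) (x : E)
    (r c : ℝ) : IntegrableOn (fun z => |f z - c|) (ball x r) μ :=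
  ((hf.integrableOn_ball x r).sub (integrableOn_const measure_ball_lt_top.ne)).abs

theorem setIntegral_ball_abs_sub_average_le {f : E → ℝ} {M r : ℝ} {x : E} (hr : 0 < r)
    (hM : ⨍ y in ball x r, |f y - ⨍ z in ball x r, f z ∂μ| ∂μ ≤ M) :
    ∫ y in ball x r, |f y - ⨍ z in ball x r, f z ∂μ| ∂μ ≤ μ.real (ball x r) * M := by
  rwa [setAverage_eq, smul_eq_mul, inv_mul_le_iff₀ (measureReal_ball_pos μ x hr)] at hM

variable [BorelSpace E]

theorem measureReal_ball_of_pos (μ : Measure E) [μ.IsAddHaarMeasure] (x : E) {r : ℝ}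
    (hr : 0 < r) : μ.real (ball x r) = r ^ finrank ℝ E * μ.real (ball 0 1) := by
  rw [Measure.real, Measure.addHaar_ball_of_pos μ x hr, ENNReal.toReal_mul,
    ENNReal.toReal_ofReal (by positivity), Measure.real]

theorem abs_average_ball_sub_average_ball_two_mul_le {f : E → ℝ} {M r : ℝ} {x : E}
    (hf : LocallyIntegrable f μ) (hr : 0 < r)
    (hM : ⨍ y in ball x (2 * r), |f y - ⨍ z in ball x (2 * r), f z ∂μ| ∂μ ≤ M) :
    |⨍ z in ball x r, f z ∂μ - ⨍ z in ball x (2 * r), f z ∂μ| ≤ 2 ^ finrank ℝ E * M := by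
  have hM' := setIntegral_ball_abs_sub_average_le (by positivity) hM
  set c := ⨍ z in ball x (2 * r), f z ∂μ
  have hB := measureReal_ball_pos μ x hr
  have h1 : ⨍ z in ball x r, f z ∂μ - c =
      (μ.real (ball x r))⁻¹ * ∫ z in ball x r, (f z - c) ∂μ := by
    rw [integral_sub (hf.integrableOn_ball x r) (integrableOn_const measure_ball_lt_top.ne),
      setIntegral_const, setAverage_eq, smul_eq_mul, smul_eq_mul]
    field_simp
  rw [h1, abs_mul, abs_of_pos (inv_pos.2 hB), inv_mul_le_iff₀ hB]
  calc |∫ z in ball x r, (f z - c) ∂μ| ≤ ∫ z in ball x r, |f z - c| ∂μ := abs_integral_le_integral_abs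
    _ ≤ ∫ z in ball x (2 * r), |f z - c| ∂μ :=
      setIntegral_mono_set (integrableOn_ball_abs_sub_const hf x _ c)
        (Eventually.of_forall fun z => abs_nonneg _)
        (ball_subset_ball (by linarith)).eventuallyLE
    _ ≤ μ.real (ball x (2 * r)) * M := hM'
    _ = μ.real (ball x r) * (2 ^ finrank ℝ E * M) := by
      rw [measureReal_ball_of_pos μ x hr, measureReal_ball_of_pos μ x (by positivity), mul_pow]
      ring

theorem abs_average_ball_two_pow_mul_sub_average_ball_le {f : E → ℝ} {M r : ℝ} {x : E}
    (hf : LocallyIntegrable f μ)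
    (hM : ∀ ρ > 0, ⨍ y in ball x ρ, |f y - ⨍ z in ball x ρ, f z ∂μ| ∂μ ≤ M) (hr : 0 < r) (k : ℕ) :
    |⨍ z in ball x (2 ^ k * r), f z ∂μ - ⨍ z in ball x r, f z ∂μ| ≤ k * (2 ^ finrank ℝ E * M) := by
  induction k with
  | zero => simp
  | succ k ih =>
    have h := abs_average_ball_sub_average_ball_two_mul_le (r := 2 ^ k * r) hf (by positivity)
      (hM _ (by positivity))
    rw [← mul_assoc, ← pow_succ', abs_sub_comm] at h
    calc _ ≤ _ := abs_sub_le _ (⨍ z in ball x (2 ^ k * r), f z ∂μ) _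
      _ ≤ 2 ^ finrank ℝ E * M + k * (2 ^ finrank ℝ E * M) := add_le_add h ih
      _ = _ := by push_cast; ring

theorem setIntegral_ball_two_pow_mul_abs_sub_average_le {f : E → ℝ} {M r : ℝ} {x : E}
    (hf : LocallyIntegrable f μ)
    (hM : ∀ ρ > 0, ⨍ y in ball x ρ, |f y - ⨍ z in ball x ρ, f z ∂μ| ∂μ ≤ M) (hr : 0 < r) (k : ℕ) :
    ∫ y in ball x (2 ^ k * r), |f y - ⨍ z in ball x r, f z ∂μ| ∂μ ≤
      μ.real (ball x (2 ^ k * r)) * ((k + 1) * (2 ^ finrank ℝ E * M)) := by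
  have hM0 : 0 ≤ M := nonneg_of_average_abs_le (hM r hr)
  have hk := abs_average_ball_two_pow_mul_sub_average_ball_le hf hM hr k
  have hρ : 0 < 2 ^ k * r := by positivity
  have hosc := setIntegral_ball_abs_sub_average_le hρ (hM _ hρ)
  set c := ⨍ z in ball x (2 ^ k * r), f z ∂μ
  set c₀ := ⨍ z in ball x r, f z ∂μ
  calc ∫ y in ball x (2 ^ k * r), |f y - c₀| ∂μ
      ≤ ∫ y in ball x (2 ^ k * r), (|f y - c| + k * (2 ^ finrank ℝ E * M)) ∂μ := by
        refine integral_mono (integrableOn_ball_abs_sub_const hf x _ _)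
          ((integrableOn_ball_abs_sub_const hf x _ _).add
            (integrableOn_const measure_ball_lt_top.ne)) fun y => ?_
        exact (abs_sub_le _ c _).trans (by gcongr)
    _ = ∫ y in ball x (2 ^ k * r), |f y - c| ∂μ +
        μ.real (ball x (2 ^ k * r)) * (k * (2 ^ finrank ℝ E * M)) := by
      rw [integral_add (integrableOn_ball_abs_sub_const hf x _ _)
        (integrableOn_const measure_ball_lt_top.ne), setIntegral_const, smul_eq_mul]
    _ ≤ μ.real (ball x (2 ^ k * r)) * M +
        μ.real (ball x (2 ^ k * r)) * (k * (2 ^ finrank ℝ E * M)) := by gcongr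
    _ ≤ _ := by
      rw [← mul_add]
      gcongr
      have : 1 * M ≤ 2 ^ finrank ℝ E * M := by gcongr; exact one_le_pow₀ one_le_two
      linarith

/-- The oscillation of a function of bounded mean oscillation is integrable against a weight
decaying slightly faster than `‖z‖ ^ (-d)`, with the expected scaling in the radius. -/
theorem exists_integral_rpow_mul_abs_sub_average_le (μ : Measure E) [μ.IsAddHaarMeasure] :
    ∃ C > 0, ∀ (f : E → ℝ) (M r : ℝ) (x : E), LocallyIntegrable f μ → 0 < r →
      (∀ ρ > 0, ⨍ y in ball x ρ, |f y - ⨍ z in ball x ρ, f z ∂μ| ∂μ ≤ M) →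
      Integrable (fun z => (r + ‖z - x‖) ^ (-(finrank ℝ E + 1 / 2) : ℝ) *
        |f z - ⨍ u in ball x r, f u ∂μ|) μ ∧
      ∫ z, (r + ‖z - x‖) ^ (-(finrank ℝ E + 1 / 2) : ℝ) * |f z - ⨍ u in ball x r, f u ∂μ| ∂μ ≤
        C * M * r ^ (-(1 / 2) : ℝ) := by
  set d := finrank ℝ E
  set V := μ.real (ball (0 : E) 1)
  have hV : 0 < V := measureReal_ball_pos μ 0 one_pos
  set q : ℝ := 2 ^ (-(1 / 2) : ℝ)
  have hq0 : 0 < q := by positivity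
  have hq1 : ‖q‖ < 1 := by
    rw [Real.norm_of_nonneg hq0.le]
    exact Real.rpow_lt_one_of_one_lt_of_neg one_lt_two (by norm_num)
  have hsum : Summable fun m : ℕ => ((m : ℝ) + 2) * q ^ m := by
    simp only [add_mul]
    exact (by simpa using summable_pow_mul_geometric_of_norm_lt_one 1 hq1 :
      Summable fun m : ℕ => (m : ℝ) * q ^ m).add
      ((summable_geometric_of_norm_lt_one hq1).mul_left 2)
  set S := ∑' m : ℕ, ((m : ℝ) + 2) * q ^ m
  have hS : 0 < S := hsum.tsum_pos (fun m => by positivity) 0 (by simp)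
  refine ⟨V * 4 ^ d * S, by positivity, fun f M r x hf hr hM => ?_⟩
  have hM0 : 0 ≤ M := nonneg_of_average_abs_le (hM r hr)
  set c := ⨍ u in ball x r, f u ∂μ
  set F : E → ℝ := fun z => (r + ‖z - x‖) ^ (-(d + 1 / 2) : ℝ) * |f z - c|
  have hF0 : ∀ z, 0 ≤ F z := fun z => by positivity
  have hFm : AEStronglyMeasurable F μ := by
    refine AEStronglyMeasurable.mul (Measurable.aestronglyMeasurable (by fun_prop)) ?_
    exact (hf.aestronglyMeasurable.sub aestronglyMeasurable_const).norm
  let A : ℕ → Set E := fun m => {z | 2 ^ m * r ≤ r + ‖z - x‖} ∩ ball x (2 ^ (m + 1) * r)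
  have hA : ⋃ m, A m = Set.univ := by
    refine Set.eq_univ_of_forall fun z => Set.mem_iUnion.2 ?_
    obtain ⟨m, hm1, hm2⟩ := exists_nat_pow_near (x := (r + ‖z - x‖) / r) (y := 2)
      (by rw [le_div_iff₀ hr]; linarith [norm_nonneg (z - x)]) one_lt_two
    rw [le_div_iff₀ hr] at hm1
    rw [div_lt_iff₀ hr] at hm2
    exact ⟨m, hm1, mem_ball_iff_norm.2 (by linarith)⟩
  have hAm : ∀ m, MeasurableSet (A m) := fun m =>
    (measurableSet_le (by fun_prop) (by fun_prop)).inter measurableSet_ball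
  have hscale : ∀ m : ℕ, (2 ^ m * r) ^ (-(d + 1 / 2) : ℝ) * (2 ^ (m + 1) * r) ^ d =
      2 ^ d * q ^ m * r ^ (-(1 / 2) : ℝ) := fun m => by
    have h1 : ∀ s : ℝ, 0 < s → s ^ (-(d + 1 / 2) : ℝ) * s ^ d = s ^ (-(1 / 2) : ℝ) := fun s hs => by
      rw [← Real.rpow_natCast, ← Real.rpow_add hs]; congr 1; ring
    calc _ = 2 ^ d * ((2 ^ m * r) ^ (-(d + 1 / 2) : ℝ) * (2 ^ m * r) ^ d) := by
          rw [pow_succ', mul_assoc, mul_pow 2]; ring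
      _ = _ := by
        rw [h1 _ (by positivity), Real.mul_rpow (by positivity) hr.le, mul_assoc,
          Real.rpow_pow_comm zero_le_two]
  have hpiece : ∀ m, ∫⁻ z in A m, ENNReal.ofReal (F z) ∂μ ≤
      ENNReal.ofReal (V * 4 ^ d * M * r ^ (-(1 / 2) : ℝ) * ((m + 2) * q ^ m)) := fun m => by
    set W : ℝ := (2 ^ m * r) ^ (-(d + 1 / 2) : ℝ)
    have hint := (integrableOn_ball_abs_sub_const hf x (2 ^ (m + 1) * r) c).const_mul W
    calc ∫⁻ z in A m, ENNReal.ofReal (F z) ∂μ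
        ≤ ∫⁻ z in A m, ENNReal.ofReal (W * |f z - c|) ∂μ := by
          refine setLIntegral_mono' (hAm m) fun z hz => ENNReal.ofReal_le_ofReal ?_
          refine mul_le_mul_of_nonneg_right ?_ (abs_nonneg _)
          refine Real.rpow_le_rpow_of_nonpos (by positivity) hz.1 ?_
          have : (0 : ℝ) ≤ d := d.cast_nonneg
          linarith
      _ ≤ ∫⁻ z in ball x (2 ^ (m + 1) * r), ENNReal.ofReal (W * |f z - c|) ∂μ :=
          lintegral_mono_set Set.inter_subset_right
      _ = ENNReal.ofReal (∫ z in ball x (2 ^ (m + 1) * r), W * |f z - c| ∂μ) :=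
          (ofReal_integral_eq_lintegral_ofReal hint
            (Eventually.of_forall fun z => by positivity)).symm
      _ ≤ _ := by
          refine ENNReal.ofReal_le_ofReal ?_
          have h := setIntegral_ball_two_pow_mul_abs_sub_average_le hf hM hr (m + 1)
          rw [measureReal_ball_of_pos μ x (by positivity)] at h
          rw [integral_const_mul]
          calc _ ≤ W * ((2 ^ (m + 1) * r) ^ d * V * (((m + 1 : ℕ) + 1) * (2 ^ d * M))) := by gcongr
            _ = (W * (2 ^ (m + 1) * r) ^ d) * V * (m + 2) * 2 ^ d * M := by push_cast; ring
            _ = _ := by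
              rw [hscale, show (4 : ℝ) = 2 * 2 by norm_num, mul_pow]; ring
  have hle : ∫⁻ z, ENNReal.ofReal (F z) ∂μ ≤
      ENNReal.ofReal (V * 4 ^ d * S * M * r ^ (-(1 / 2) : ℝ)) := by
    calc ∫⁻ z, ENNReal.ofReal (F z) ∂μ = ∫⁻ z in ⋃ m, A m, ENNReal.ofReal (F z) ∂μ := by
          rw [hA, setLIntegral_univ]
      _ ≤ ∑' m, ∫⁻ z in A m, ENNReal.ofReal (F z) ∂μ := lintegral_iUnion_le _ _
      _ ≤ ∑' m : ℕ, ENNReal.ofReal (V * 4 ^ d * M * r ^ (-(1 / 2) : ℝ) * ((m + 2) * q ^ m)) :=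
          ENNReal.tsum_le_tsum hpiece
      _ = _ := by
          rw [← ENNReal.ofReal_tsum_of_nonneg (fun m => by positivity) (hsum.mul_left _),
            tsum_mul_left]
          congr 1
          ring
  refine ⟨⟨hFm, ?_⟩, ?_⟩
  · rw [hasFiniteIntegral_iff_ofReal (Eventually.of_forall hF0)]
    exact hle.trans_lt ENNReal.ofReal_lt_top
  · rw [integral_eq_lintegral_of_nonneg_ae (Eventually.of_forall hF0) hFm]
    exact ENNReal.toReal_le_of_le_ofReal (by positivity) hle

end MeanOscillation

/-- If the kernels `k s` are Lipschitz in `s` near `t` with a constant `K z` integrable against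
`|g|`, then the derivative of `s ↦ ∫ k s z * g z` at `t` is at most `∫ K z * |g z|`. -/
theorem abs_deriv_integral_mul_le {α : Type*} [MeasurableSpace α] {μ : Measure α}
    {k : ℝ → α → ℝ} {g K : α → ℝ} {t : ℝ}
    (hk : ∀ s, AEStronglyMeasurable (k s) μ) (hg : AEStronglyMeasurable g μ)
    (hK : Integrable (fun z => K z * |g z|) μ) (hK0 : ∀ z, 0 ≤ K z)
    (hlip : ∀ᶠ s in nhds t, ∀ z, |k s z - k t z| ≤ K z * |s - t|) :
    |deriv (fun s => ∫ z, k s z * g z ∂μ) t| ≤ ∫ z, K z * |g z| ∂μ := by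
  refine norm_deriv_le_of_lip' (f := fun s => ∫ z, k s z * g z ∂μ)
    (integral_nonneg fun z => mul_nonneg (hK0 z) (abs_nonneg _)) ?_
  filter_upwards [hlip] with s hs
  have hbound : ∀ z, ‖k s z * g z - k t z * g z‖ ≤ K z * |g z| * ‖s - t‖ := fun z => by
    rw [← sub_mul, norm_mul, mul_right_comm]
    exact mul_le_mul_of_nonneg_right (hs z) (abs_nonneg _)
  have hdiff : Integrable (fun z => k s z * g z - k t z * g z) μ :=
    (hK.mul_const ‖s - t‖).mono' (((hk s).mul hg).sub ((hk t).mul hg)) (.of_forall hbound)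
  rw [← integral_mul_const]
  by_cases ht : Integrable (fun z => k t z * g z) μ
  · have hs' : Integrable (fun z => k s z * g z) μ := 
      (hdiff.add ht).congr (.of_forall fun z => sub_add_cancel _ _)
    rw [← integral_sub hs' ht]
    exact norm_integral_le_of_norm_le (hK.mul_const _) (.of_forall hbound)
  · have hs' : ¬ Integrable (fun z => k s z * g z) μ := fun h =>
      ht ((h.sub hdiff).congr (.of_forall fun z => sub_sub_cancel _ _))
    rw [integral_undef ht, integral_undef hs', sub_zero, norm_zero]
    exact integral_nonneg fun z => by have := hK0 z; positivity

/-- Difference-quotient form of the kernel estimate, uniform in the convolution variable. -/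
theorem exists_eventually_abs_schwartzDil_sub_le {n : ℕ}
    (φ : SchwartzMap (EuclideanSpace ℝ (Fin n)) ℝ) :
    ∃ C > 0, ∀ (x₀ x y : EuclideanSpace ℝ (Fin n)) (r t : ℝ), 0 < r → r < t →
      x ∈ ball x₀ r → y ∈ ball x₀ r → ∀ᶠ s in nhds t, ∀ z,
        |(schwartzDil φ s (x - z) - schwartzDil φ s (y - z)) -
          (schwartzDil φ t (x - z) - schwartzDil φ t (y - z))| ≤
        C * r * t ^ (-(3 / 2) : ℝ) * (r + ‖z - x₀‖) ^ (-(n + 1 / 2) : ℝ) * |s - t| := by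
  obtain ⟨ψ, hψ⟩ := exists_hasDerivAt_schwartzDil φ
  obtain ⟨C, hC0, hC⟩ := exists_abs_kernel_sub_le ψ
  refine ⟨C * 2 ^ (3 / 2 : ℝ), by positivity, fun x₀ x y r t hr hrt hx hy => ?_⟩
  have ht : 0 < t := hr.trans hrt
  have hmem : max r (t / 2) < t := max_lt hrt (half_lt_self ht)
  filter_upwards [lt_mem_nhds hmem] with s hs z
  refine Convex.norm_image_sub_le_of_norm_hasDerivWithin_le (s := Set.Ioi (max r (t / 2)))
    (f := fun s => schwartzDil φ s (x - z) - schwartzDil φ s (y - z))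
    (f' := fun u => u ^ (-(n : ℤ) - 1) * ψ (u⁻¹ • (x - z)) -
      u ^ (-(n : ℤ) - 1) * ψ (u⁻¹ • (y - z)))
    (fun u hu => ?_) (fun u hu => ?_) (convex_Ioi _) hmem hs
  · have hu0 : u ≠ 0 := (hr.trans ((le_max_left _ _).trans_lt hu)).ne'
    exact ((hψ (x - z) u hu0).sub (hψ (y - z) u hu0)).hasDerivWithinAt
  · obtain ⟨hru, htu⟩ := max_lt_iff.1 (Set.mem_Ioi.1 hu)
    have hpow : u ^ (-(3 / 2) : ℝ) ≤ 2 ^ (3 / 2 : ℝ) * t ^ (-(3 / 2) : ℝ) := by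
      calc u ^ (-(3 / 2) : ℝ) ≤ (2⁻¹ * t) ^ (-(3 / 2) : ℝ) :=
            Real.rpow_le_rpow_of_nonpos (by positivity) (by linarith) (by norm_num)
        _ = _ := by
          rw [Real.mul_rpow (by positivity) ht.le, Real.inv_rpow zero_le_two,
            Real.rpow_neg zero_le_two, inv_inv]
    refine (hC x₀ x y z r u hr hru.le hx hy).trans ?_
    calc _ ≤ C * r * (2 ^ (3 / 2 : ℝ) * t ^ (-(3 / 2) : ℝ)) *
          (r + ‖z - x₀‖) ^ (-(n + 1 / 2) : ℝ) := by gcongr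
      _ = _ := by ring

theorem setIntegral_Ioi_le_of_le_mul_rpow {F : ℝ → ℝ} {K r : ℝ} (hr : 0 < r)
    (hF0 : ∀ t, 0 ≤ F t) (hF : ∀ t, r < t → F t ≤ K * t ^ (-(3 / 2) : ℝ)) :
    ∫ t in Set.Ioi r, F t ≤ 2 * K * r ^ (-(1 / 2) : ℝ) := by
  have hlt : (-(3 / 2) : ℝ) < -1 := by norm_num
  calc ∫ t in Set.Ioi r, F t ≤ ∫ t in Set.Ioi r, K * t ^ (-(3 / 2) : ℝ) :=
        integral_mono_of_nonneg (.of_forall hF0) ((integrableOn_Ioi_rpow_of_lt hlt hr).const_mul K)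
          ((ae_restrict_iff' measurableSet_Ioi).2 (.of_forall hF))
    _ = _ := by
      rw [integral_const_mul, integral_Ioi_rpow_of_lt hlt hr,
        show (-(3 / 2) + 1 : ℝ) = -(1 / 2) by norm_num]
      ring

theorem stmt12 (n : ℕ) (φ : SchwartzMap (EuclideanSpace ℝ (Fin n)) ℝ)
    (hφ : ∫ x, φ x = 1) :
    ∃ C > 0, ∀ (f : EuclideanSpace ℝ (Fin n) → ℝ) (M : ℝ),
      LocallyIntegrable f volume →
      (∀ (c : EuclideanSpace ℝ (Fin n)) (ρ : ℝ), 0 < ρ →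
        ⨍ y in ball c ρ, |f y - ⨍ z in ball c ρ, f z| ≤ M) →
      ∀ (x₀ : EuclideanSpace ℝ (Fin n)) (r : ℝ), 0 < r →
        ∀ᵐ x ∂(volume.restrict (ball x₀ r)), ∀ᵐ y ∂(volume.restrict (ball x₀ r)),
          ∫ t in Set.Ioi r,
              |deriv (fun s : ℝ =>
                ∫ z, (schwartzDil φ s (x - z) - schwartzDil φ s (y - z)) *
                  (f z - ⨍ u in ball x₀ r, f u)) t|
            ≤ C * M := by
  obtain ⟨C₁, hC₁0, hC₁⟩ := exists_eventually_abs_schwartzDil_sub_le φ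
  obtain ⟨C₂, hC₂0, hC₂⟩ :=
    exists_integral_rpow_mul_abs_sub_average_le (volume : Measure (EuclideanSpace ℝ (Fin n)))
  rw [finrank_euclideanSpace_fin] at hC₂
  refine ⟨2 * C₁ * C₂, by positivity, fun f M hf hM x₀ r hr => ?_⟩
  refine ae_restrict_of_forall_mem measurableSet_ball fun x hx =>
    ae_restrict_of_forall_mem measurableSet_ball fun y hy => ?_
  obtain ⟨hint, hle⟩ := hC₂ f M r x₀ hf hr (hM x₀)
  set g : EuclideanSpace ℝ (Fin n) → ℝ := fun z => f z - ⨍ u in ball x₀ r, f u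
  set w : EuclideanSpace ℝ (Fin n) → ℝ := fun z => (r + ‖z - x₀‖) ^ (-(n + 1 / 2) : ℝ)
  have hφm : Continuous φ := φ.continuous
  have hmeas : ∀ s, AEStronglyMeasurable
      (fun z => schwartzDil φ s (x - z) - schwartzDil φ s (y - z)) volume := fun s => by
    unfold schwartzDil
    exact Continuous.aestronglyMeasurable (by fun_prop)
  have hderiv : ∀ t, r < t → |deriv (fun s : ℝ =>
      ∫ z, (schwartzDil φ s (x - z) - schwartzDil φ s (y - z)) * g z) t| ≤
      C₁ * r * (C₂ * M * r ^ (-(1 / 2) : ℝ)) * t ^ (-(3 / 2) : ℝ) := fun t hrt => by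
    have ht : 0 < t := hr.trans hrt
    have heq : ∀ z, C₁ * r * t ^ (-(3 / 2) : ℝ) * w z * |g z| =
        C₁ * r * t ^ (-(3 / 2) : ℝ) * (w z * |g z|) := fun z => mul_assoc _ _ _
    refine (abs_deriv_integral_mul_le (g := g) (K := fun z => C₁ * r * t ^ (-(3 / 2) : ℝ) * w z) hmeas
      (hf.aestronglyMeasurable.sub aestronglyMeasurable_const) ?_ (fun z => by positivity)
      (hC₁ x₀ x y r t hr hrt hx hy)).trans ?_
    · simp only [heq]
      exact hint.const_mul _
    · simp only [heq]
      rw [integral_const_mul]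
      calc _ ≤ C₁ * r * t ^ (-(3 / 2) : ℝ) * (C₂ * M * r ^ (-(1 / 2) : ℝ)) := by gcongr
        _ = _ := by ring
  refine (setIntegral_Ioi_le_of_le_mul_rpow hr (fun t => abs_nonneg _) hderiv).trans_eq ?_
  have hrr : r * (r ^ (-(1 / 2) : ℝ) * r ^ (-(1 / 2) : ℝ)) = 1 := by
    rw [← Real.rpow_add hr, show (-(1 / 2) + -(1 / 2) : ℝ) = -1 by norm_num, Real.rpow_neg_one,
      mul_inv_cancel₀ hr.ne']
  linear_combination (2 * C₁ * C₂ * M) * hrr
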